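/- arXiv:2003.12446 — 8 statements merged into one kernel-verified Lean document; each statement's English description precedes it below -/
import Mathlib

section
/- Let n ≥ 1 be an integer and let ψ satisfy the stated assumptions. Then the derivative H'(ρ) = (∫_0^ρ ψ(ζ)^{n−1} dζ)/ψ(ρ)^{n−1} (with H'(0) = 0) satisfies, for every r ≥ 0, the identity H(r) = H'(r)²/2 + (n−1)·∫_0^r (ψ'(ρ)/ψ(ρ))·H'(ρ)² dρ. -/
open MeasureTheory intervalIntegral

lemma hasDerivAt_integral_of_continuousOn_Ici {f : ℝ → ℝ} (hf : ContinuousOn f (Set.Ici 0))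
    {x : ℝ} (hx : 0 < x) : HasDerivAt (fun u => ∫ t in (0:ℝ)..u, f t) (f x) x := by
  refine integral_hasDerivAt_right ?_ ?_ (hf.continuousAt (Ici_mem_nhds hx))
  · refine (hf.mono ?_).intervalIntegrable
    rw [Set.uIcc_of_le hx.le]
    exact Set.Icc_subset_Ici_self
  · exact (hf.mono Set.Ioi_subset_Ici_self).stronglyMeasurableAtFilter isOpen_Ioi x hx

lemma continuousOn_Icc_integral_of_continuousOn_Ici {f : ℝ → ℝ}
    (hf : ContinuousOn f (Set.Ici 0)) {r : ℝ} (hr : 0 ≤ r) :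
    ContinuousOn (fun u => ∫ t in (0:ℝ)..u, f t) (Set.Icc 0 r) := by
  have h : IntervalIntegrable f volume 0 r := by
    refine (hf.mono ?_).intervalIntegrable
    rw [Set.uIcc_of_le hr]
    exact Set.Icc_subset_Ici_self
  have := continuousOn_primitive_interval' h Set.left_mem_uIcc
  rwa [Set.uIcc_of_le hr] at this

lemma hasDerivAt_div_pow {P ψ : ℝ → ℝ} {m : ℕ} {x p : ℝ} (hP : HasDerivAt P (ψ x ^ m) x)
    (hψ : HasDerivAt ψ p x) (h0 : ψ x ≠ 0) :
    HasDerivAt (fun u => P u / ψ u ^ m) (1 - m * (p / ψ x) * (P x / ψ x ^ m)) x := by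
  refine (hP.fun_div (hψ.fun_pow m) (pow_ne_zero m h0)).congr_deriv ?_
  rcases m with _ | k
  · simp
  · simp only [Nat.add_sub_cancel, pow_succ, Nat.cast_add, Nat.cast_one]
    field_simp

theorem stmt_0 (n : ℕ) (hn : 1 ≤ n) (ψ : ℝ → ℝ)
    (hψC1 : ContDiffOn ℝ 1 ψ (Set.Ici 0))
    (hψsmooth : ContDiffOn ℝ (⊤ : ℕ∞) ψ (Set.Ioi 0))
    (hψ0 : ψ 0 = 0)
    (hψ'0 : derivWithin ψ (Set.Ici 0) 0 = 1)
    (hψ'nonneg : ∀ r : ℝ, 0 ≤ r → 0 ≤ derivWithin ψ (Set.Ici 0) r)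
    (hψpos : ∀ r : ℝ, 0 < r → 0 < ψ r)
    (H' H : ℝ → ℝ)
    (hH' : ∀ ρ : ℝ, H' ρ = (∫ ζ in (0:ℝ)..ρ, ψ ζ ^ (n - 1)) / ψ ρ ^ (n - 1))
    (hH : ∀ r : ℝ, H r = ∫ ρ in (0:ℝ)..r, H' ρ) :
    ∀ r : ℝ, 0 ≤ r →
      H r = (H' r) ^ 2 / 2
        + ((n : ℝ) - 1) * ∫ ρ in (0:ℝ)..r, (deriv ψ ρ / ψ ρ) * (H' ρ) ^ 2 := by
  intro r hr
  obtain ⟨m, rfl⟩ : ∃ m, n = m + 1 := ⟨n - 1, by omega⟩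
  simp only [Nat.add_sub_cancel] at hH'
  have hc : ContinuousOn ψ (Set.Ici 0) := hψC1.continuousOn
  have hcm : ContinuousOn (fun x => ψ x ^ m) (Set.Ici 0) := hc.pow m
  have hψd : ∀ x, 0 < x → HasDerivAt ψ (deriv ψ x) x := fun x hx =>
    ((hψC1.differentiableOn (by simp)).differentiableAt (Ici_mem_nhds hx)).hasDerivAt
  have hψd_nonneg : ∀ x, 0 < x → 0 ≤ deriv ψ x := fun x hx => by
    rw [← derivWithin_of_mem_nhds (Ici_mem_nhds hx)]
    exact hψ'nonneg x hx.le
  have hmono : MonotoneOn ψ (Set.Ici 0) := by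
    refine monotoneOn_of_deriv_nonneg (convex_Ici 0) hc ?_ ?_
    · rw [interior_Ici]
      exact fun x hx => (hψd x hx).differentiableAt.differentiableWithinAt
    · rw [interior_Ici]
      exact fun x hx => hψd_nonneg x hx
  have hψnn : ∀ x, 0 ≤ x → 0 ≤ ψ x := fun x hx => hψ0 ▸ hmono Set.self_mem_Ici hx hx
  have hH'd : ∀ x, 0 < x → HasDerivAt H' (1 - m * (deriv ψ x / ψ x) * H' x) x := by
    intro x hx
    have := hasDerivAt_div_pow (hasDerivAt_integral_of_continuousOn_Ici hcm hx) (hψd x hx)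
      (hψpos x hx).ne'
    rw [hH' x]
    exact this.congr_of_eventuallyEq (Filter.Eventually.of_forall hH')
  have hH'0 : H' 0 = 0 := by simp [hH']
  have hH'nn : ∀ x, 0 ≤ x → 0 ≤ H' x := by
    intro x hx
    rw [hH']
    exact div_nonneg (integral_nonneg hx fun t ht => pow_nonneg (hψnn t ht.1) m)
      (pow_nonneg (hψnn x hx) m)
  have hH'le : ∀ x, 0 ≤ x → H' x ≤ x := by
    intro x hx
    rcases hx.eq_or_lt with rfl | hx'
    · exact hH'0.le
    rw [hH', div_le_iff₀ (pow_pos (hψpos x hx') m)]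
    have hint : IntervalIntegrable (fun t => ψ t ^ m) volume 0 x := by
      refine (hcm.mono ?_).intervalIntegrable
      rw [Set.uIcc_of_le hx]
      exact Set.Icc_subset_Ici_self
    calc ∫ t in (0:ℝ)..x, ψ t ^ m ≤ ∫ _ in (0:ℝ)..x, ψ x ^ m :=
          integral_mono_on hx hint intervalIntegrable_const fun t ht =>
            pow_le_pow_left₀ (hψnn t ht.1) (hmono ht.1 hx ht.2) m
      _ = x * ψ x ^ m := by simp
  have hH'c : ContinuousOn H' (Set.Ici 0) := by
    intro x hx
    rcases (Set.mem_Ici.1 hx).eq_or_lt with rfl | hx'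
    · have h0 : Filter.Tendsto (fun x : ℝ => x) (nhdsWithin 0 (Set.Ici 0)) (nhds 0) :=
        Filter.tendsto_id.mono_left nhdsWithin_le_nhds
      rw [ContinuousWithinAt, hH'0]
      refine tendsto_of_tendsto_of_tendsto_of_le_of_le' tendsto_const_nhds h0 ?_ ?_
      · filter_upwards [self_mem_nhdsWithin] with y hy using hH'nn y hy
      · filter_upwards [self_mem_nhdsWithin] with y hy using hH'le y hy
    · exact (hH'd x hx').continuousAt.continuousWithinAt
  let G : ℝ → ℝ := fun x => (∫ t in (0:ℝ)..x, H' t) - H' x ^ 2 / 2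
  have hGc : ContinuousOn G (Set.Icc 0 r) :=
    (continuousOn_Icc_integral_of_continuousOn_Ici hH'c hr).sub
      (((hH'c.mono Set.Icc_subset_Ici_self).pow 2).div_const 2)
  have hGd : ∀ x ∈ Set.Ioo 0 r, HasDerivAt G (m * (deriv ψ x / ψ x * H' x ^ 2)) x := by
    intro x hx
    refine ((hasDerivAt_integral_of_continuousOn_Ici hH'c hx.1).fun_sub
      (((hH'd x hx.1).fun_pow 2).div_const 2)).congr_deriv ?_
    simp only [Nat.cast_ofNat]
    ring
  have hint : IntervalIntegrable (fun x => m * (deriv ψ x / ψ x * H' x ^ 2)) volume 0 r := by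
    rw [intervalIntegrable_iff_integrableOn_Ioc_of_le hr]
    refine integrableOn_deriv_of_nonneg hGc hGd fun x hx => ?_
    have := hψd_nonneg x hx.1
    have := hψpos x hx.1
    positivity
  have key := integral_eq_sub_of_hasDerivAt_of_le hr hGc hGd hint
  rw [intervalIntegral.integral_const_mul] at key
  simp only [G, integral_same, hH'0] at key
  rw [hH]
  push_cast
  rw [add_sub_cancel_right, key]
  ring
end

section
/- Let n ≥ 1 be an integer and let ψ satisfy the stated assumptions. Then for every r ≥ 0 one has H'(r)² ≤ 2·H(r), where H'(ρ) = (∫_0^ρ ψ(ζ)^{n−1} dζ)/ψ(ρ)^{n−1} for ρ > 0 and H'(0) = 0. -/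
open MeasureTheory intervalIntegral

/-- A nonnegative function on `[0, r]` lying above the line of slope one through its value at `r`
has integral at least half the square of that value. -/
theorem sq_le_two_mul_integral_of_sub_le {g : ℝ → ℝ} {r : ℝ} (hr : g r ≤ r) (hr0 : 0 ≤ g r)
    (hg : ∀ s ∈ Set.Ioc 0 r, 0 ≤ g s) (hslope : ∀ s ∈ Set.Ioc 0 r, g r - (r - s) ≤ g s)
    (hint : IntervalIntegrable g volume 0 r) : g r ^ 2 ≤ 2 * ∫ s in (0:ℝ)..r, g s := by
  have h0a : 0 ≤ r - g r := by linarith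
  have har : r - g r ≤ r := by linarith
  have h0r : 0 ≤ r := by linarith
  have hint₁ : IntervalIntegrable g volume 0 (r - g r) := hint.mono_set (by
    rw [Set.uIcc_of_le h0a, Set.uIcc_of_le h0r]; exact Set.Icc_subset_Icc_right har)
  have hint₂ : IntervalIntegrable g volume (r - g r) r := hint.mono_set (by
    rw [Set.uIcc_of_le har, Set.uIcc_of_le h0r]; exact Set.Icc_subset_Icc_left h0a)
  have h₁ : 0 ≤ ∫ s in (0:ℝ)..(r - g r), g s := by
    rw [integral_of_le h0a]
    exact setIntegral_nonneg measurableSet_Ioc fun s hs => hg s ⟨hs.1, hs.2.trans har⟩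
  have h₂ : ∫ s in (r - g r)..r, (s - (r - g r)) ≤ ∫ s in (r - g r)..r, g s := by
    refine integral_mono_on_of_le_Ioo har
      (Continuous.intervalIntegrable (by fun_prop) _ _) hint₂ ?_
    intro s hs
    linarith [hslope s ⟨h0a.trans_lt hs.1, hs.2.le⟩]
  have h₃ : ∫ s in (r - g r)..r, (s - (r - g r)) = g r ^ 2 / 2 := by
    rw [integral_comp_sub_right (fun x => x), integral_id]
    ring
  have h₄ := integral_add_adjacent_intervals hint₁ hint₂
  linarith

/-- The quotient of the primitive of a continuous nondecreasing weight by the weight itself has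
increments bounded by those of the identity. -/
theorem primitive_div_sub_le {w : ℝ → ℝ} (hmono : MonotoneOn w (Set.Ici 0))
    (hpos : ∀ r, 0 < r → 0 < w r) (hw0 : 0 ≤ w 0) {s r : ℝ} (hs : 0 ≤ s) (hsr : s ≤ r) :
    (∫ ζ in (0:ℝ)..r, w ζ) / w r - (r - s) ≤ (∫ ζ in (0:ℝ)..s, w ζ) / w s := by
  have hint : ∀ a b : ℝ, 0 ≤ a → a ≤ b → IntervalIntegrable w volume a b := fun a b ha hab =>
    (hmono.mono (by rw [Set.uIcc_of_le hab]; exact fun x hx => ha.trans hx.1)).intervalIntegrable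
  have hr0 : 0 ≤ r := hs.trans hsr
  have hw : ∀ x, 0 ≤ x → 0 ≤ w x := fun x hx => hw0.trans (hmono Set.self_mem_Ici hx hx)
  rcases hr0.eq_or_lt with rfl | hr
  · obtain rfl : s = 0 := le_antisymm hsr hs
    simp
  have hadd := integral_add_adjacent_intervals (hint 0 s le_rfl hs) (hint s r hs hsr)
  have hF : 0 ≤ ∫ ζ in (0:ℝ)..s, w ζ := integral_nonneg hs fun x hx => hw x hx.1
  have hup : ∫ ζ in s..r, w ζ ≤ (r - s) * w r := by
    have := integral_mono_on hsr (hint s r hs hsr) (intervalIntegrable_const (c := w r))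
      fun x hx => hmono (hs.trans hx.1) hr0 hx.2
    simpa using this
  have h₁ : (∫ ζ in s..r, w ζ) / w r ≤ r - s := (div_le_iff₀ (hpos r hr)).2 hup
  have h₂ : (∫ ζ in (0:ℝ)..s, w ζ) / w r ≤ (∫ ζ in (0:ℝ)..s, w ζ) / w s := by
    rcases hs.eq_or_lt with rfl | hs'
    · simp
    · exact div_le_div_of_nonneg_left hF (hpos s hs') (hmono hs hr0 hsr)
  rw [← hadd, add_div]
  linarith

/-- If `h` is the quotient of the primitive of a continuous nondecreasing weight by the weight itself,
then `h r ^ 2` is at most twice the integral of `h` over `[0, r]`. -/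
theorem sq_primitive_div_le {w : ℝ → ℝ} (hcont : ContinuousOn w (Set.Ici 0))
    (hmono : MonotoneOn w (Set.Ici 0)) (hpos : ∀ r, 0 < r → 0 < w r) (hw0 : 0 ≤ w 0)
    {r : ℝ} (hr : 0 ≤ r) :
    ((∫ ζ in (0:ℝ)..r, w ζ) / w r) ^ 2 ≤
      2 * ∫ ρ in (0:ℝ)..r, (∫ ζ in (0:ℝ)..ρ, w ζ) / w ρ := by
  have hw : ∀ x, 0 ≤ x → 0 ≤ w x := fun x hx => hw0.trans (hmono Set.self_mem_Ici hx hx)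
  have hnonneg : ∀ s, 0 ≤ s → 0 ≤ (∫ ζ in (0:ℝ)..s, w ζ) / w s := fun s hs =>
    div_nonneg (integral_nonneg hs fun x hx => hw x hx.1) (hw s hs)
  have hle : ∀ s, 0 ≤ s → (∫ ζ in (0:ℝ)..s, w ζ) / w s ≤ s := fun s hs => by
    have := primitive_div_sub_le hmono hpos hw0 le_rfl hs
    simp only [integral_same, zero_div, sub_zero] at this
    linarith
  refine sq_le_two_mul_integral_of_sub_le (g := fun ρ => (∫ ζ in (0:ℝ)..ρ, w ζ) / w ρ)
    (hle r hr) (hnonneg r hr) (fun s hs => hnonneg s hs.1.le)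
    (fun s hs => primitive_div_sub_le hmono hpos hw0 hs.1.le hs.2) ?_
  have hIcc : ContinuousOn w (Set.Icc 0 r) := hcont.mono Set.Icc_subset_Ici_self
  have hprim : ContinuousOn (fun ρ => ∫ ζ in (0:ℝ)..ρ, w ζ) (Set.Icc 0 r) := by
    rw [← Set.uIcc_of_le hr]
    refine continuousOn_primitive_interval ?_
    rw [Set.uIcc_of_le hr]
    exact hIcc.integrableOn_Icc
  have hquot : ContinuousOn (fun ρ => (∫ ζ in (0:ℝ)..ρ, w ζ) / w ρ) (Set.Ioc 0 r) :=
    (hprim.mono Set.Ioc_subset_Icc_self).div (hIcc.mono Set.Ioc_subset_Icc_self)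
      fun x hx => (hpos x hx.1).ne'
  rw [intervalIntegrable_iff_integrableOn_Ioc_of_le hr]
  refine IntegrableOn.of_bound (C := r) measure_Ioc_lt_top
    (hquot.aestronglyMeasurable measurableSet_Ioc) ?_
  filter_upwards [ae_restrict_mem measurableSet_Ioc] with s hs
  rw [Real.norm_of_nonneg (hnonneg s hs.1.le)]
  exact (hle s hs.1.le).trans hs.2

theorem stmt_1 (n : ℕ) (hn : 1 ≤ n) (ψ : ℝ → ℝ)
    (hψC1 : ContDiffOn ℝ 1 ψ (Set.Ici 0))
    (hψsmooth : ContDiffOn ℝ (⊤ : ℕ∞) ψ (Set.Ioi 0))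
    (hψ0 : ψ 0 = 0)
    (hψ'0 : derivWithin ψ (Set.Ici 0) 0 = 1)
    (hψ'nonneg : ∀ r : ℝ, 0 ≤ r → 0 ≤ derivWithin ψ (Set.Ici 0) r)
    (hψpos : ∀ r : ℝ, 0 < r → 0 < ψ r)
    (H' H : ℝ → ℝ)
    (hH' : ∀ ρ : ℝ, H' ρ = (∫ ζ in (0:ℝ)..ρ, ψ ζ ^ (n - 1)) / ψ ρ ^ (n - 1))
    (hH : ∀ r : ℝ, H r = ∫ ρ in (0:ℝ)..r, H' ρ) :
    ∀ r : ℝ, 0 ≤ r → (H' r) ^ 2 ≤ 2 * H r := by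
  intro r hr
  have hmono : MonotoneOn ψ (Set.Ici 0) := by
    refine monotoneOn_of_deriv_nonneg (convex_Ici 0) hψC1.continuousOn
      ((hψC1.differentiableOn one_ne_zero).mono interior_subset) fun x hx => ?_
    rw [interior_Ici] at hx
    rw [← derivWithin_of_mem_nhds (Ici_mem_nhds hx)]
    exact hψ'nonneg x (le_of_lt hx)
  have hnonneg : ∀ x, 0 ≤ x → 0 ≤ ψ x := fun x hx =>
    hψ0.ge.trans (hmono Set.self_mem_Ici hx hx)
  rw [hH, funext hH']
  exact sq_primitive_div_le (w := fun ζ => ψ ζ ^ (n - 1)) (hψC1.continuousOn.pow _)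
    (fun x hx y hy hxy => pow_le_pow_left₀ (hnonneg x hx) (hmono hx hy hxy) _)
    (fun x hx => pow_pos (hψpos x hx) _) (pow_nonneg hψ0.ge _) hr
end

section
/- Let n ≥ 1 be an integer and let ψ satisfy the stated assumptions. Then H'(0) = 0 and lim_{r→0⁺} H'(r)/r = 1/n; in particular H'' extends continuously to r = 0 with value 1/n. -/
open MeasureTheory intervalIntegral

open Filter Set Topology

/-- The fundamental theorem of calculus on the half-line. -/
theorem hasDerivAt_integral_of_continuousOn_Ici_s5 {g : ℝ → ℝ} (hg : ContinuousOn g (Ici 0)) {r : ℝ}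
    (hr : 0 < r) : HasDerivAt (fun x => ∫ t in (0 : ℝ)..x, g t) (g r) r := by
  have hint : IntervalIntegrable g volume 0 r := by
    refine (hg.mono ?_).intervalIntegrable
    rw [uIcc_of_le hr.le]
    exact Icc_subset_Ici_self
  exact integral_hasDerivAt_right hint
    ((hg.mono Ioi_subset_Ici_self).stronglyMeasurableAtFilter isOpen_Ioi r hr)
    (hg.continuousAt (Ici_mem_nhds hr))

theorem tendsto_integral_nhdsGT_zero {g : ℝ → ℝ} (hg : ContinuousOn g (Ici 0)) :
    Tendsto (fun x => ∫ t in (0 : ℝ)..x, g t) (𝓝[>] 0) (𝓝 0) := by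
  have hint : IntegrableOn g (uIcc 0 1) := by
    rw [uIcc_of_le zero_le_one]
    exact (hg.mono Icc_subset_Ici_self).integrableOn_Icc
  have h := (continuousOn_primitive_interval hint) 0 left_mem_uIcc
  rw [uIcc_of_le zero_le_one] at h
  simpa [ContinuousWithinAt] using
    h.tendsto.mono_left (nhdsWithin_le_of_mem (Icc_mem_nhdsGT zero_lt_one))

/-- If `g r ~ r ^ m` as `r → 0⁺`, then `∫₀ʳ g ~ r ^ (m + 1) / (m + 1)`. -/
theorem tendsto_integral_div_pow_succ {g : ℝ → ℝ} (hg : ContinuousOn g (Ici 0)) (m : ℕ)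
    (h : Tendsto (fun r => g r / r ^ m) (𝓝[>] 0) (𝓝 1)) :
    Tendsto (fun r => (∫ t in (0 : ℝ)..r, g t) / r ^ (m + 1)) (𝓝[>] 0)
      (𝓝 (1 / ((m : ℝ) + 1))) := by
  have hm : (m : ℝ) + 1 ≠ 0 := by positivity
  refine HasDerivAt.lhopital_zero_nhdsGT (f' := g) (g' := fun r => ((m : ℝ) + 1) * r ^ m)
    ?_ ?_ ?_ (tendsto_integral_nhdsGT_zero hg) ?_ ?_
  · filter_upwards [self_mem_nhdsWithin] with r hr
    exact hasDerivAt_integral_of_continuousOn_Ici_s5 hg hr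
  · filter_upwards with r
    simpa using hasDerivAt_pow (m + 1) r
  · filter_upwards [self_mem_nhdsWithin] with r (hr : 0 < r)
    positivity
  · have : Tendsto (fun r : ℝ => r ^ (m + 1)) (𝓝 0) (𝓝 (0 ^ (m + 1))) :=
      (continuous_pow (m + 1)).tendsto 0
    simpa using this.mono_left nhdsWithin_le_nhds
  · refine (h.div_const ((m : ℝ) + 1)).congr fun r => ?_
    rw [div_div, mul_comm]

theorem stmt_5 (n : ℕ) (hn : 1 ≤ n) (ψ : ℝ → ℝ)
    (hψC1 : ContDiffOn ℝ 1 ψ (Set.Ici 0))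
    (hψsmooth : ContDiffOn ℝ (⊤ : ℕ∞) ψ (Set.Ioi 0))
    (hψ0 : ψ 0 = 0)
    (hψ'0 : derivWithin ψ (Set.Ici 0) 0 = 1)
    (hψ'nonneg : ∀ r : ℝ, 0 ≤ r → 0 ≤ derivWithin ψ (Set.Ici 0) r)
    (hψpos : ∀ r : ℝ, 0 < r → 0 < ψ r)
    (H' H : ℝ → ℝ)
    (hH' : ∀ ρ : ℝ, H' ρ = (∫ ζ in (0:ℝ)..ρ, ψ ζ ^ (n - 1)) / ψ ρ ^ (n - 1))
    (hH : ∀ r : ℝ, H r = ∫ ρ in (0:ℝ)..r, H' ρ) :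
    H' 0 = 0 ∧
      Filter.Tendsto (fun r => H' r / r) (nhdsWithin 0 (Set.Ioi 0)) (nhds (1 / (n : ℝ))) ∧
      Filter.Tendsto (deriv H') (nhdsWithin 0 (Set.Ioi 0)) (nhds (1 / (n : ℝ))) := by
  obtain ⟨m, rfl⟩ := Nat.exists_eq_add_of_le' hn
  simp only [Nat.add_sub_cancel, Nat.cast_add, Nat.cast_one] at hH' ⊢
  have hm : (m : ℝ) + 1 ≠ 0 := by positivity
  have hcont : ContinuousOn (fun r => ψ r ^ m) (Ici 0) := hψC1.continuousOn.pow m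
  have hdiff := hψC1.differentiableOn one_ne_zero
  have hderiv : ∀ r, 0 < r → HasDerivAt ψ (derivWithin ψ (Ici 0) r) r := fun r hr =>
    (hdiff r hr.le).hasDerivWithinAt.hasDerivAt (Ici_mem_nhds hr)
  have hderiv_lim : Tendsto (derivWithin ψ (Ici 0)) (𝓝[>] 0) (𝓝 1) := by
    have h := hψC1.continuousOn_derivWithin (uniqueDiffOn_Ici 0) le_rfl 0 self_mem_Ici
    rw [ContinuousWithinAt, hψ'0] at h
    exact h.mono_left (nhdsWithin_mono _ Ioi_subset_Ici_self)
  have hratio : Tendsto (fun r => ψ r / r) (𝓝[>] 0) (𝓝 1) := by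
    have h := (hdiff 0 self_mem_Ici).hasDerivWithinAt
    rw [hψ'0, hasDerivWithinAt_iff_tendsto_slope, Ici_sdiff_left] at h
    refine h.congr fun r => ?_
    simp [slope_def_field, hψ0]
  have hratio_pow : Tendsto (fun r => ψ r ^ m / r ^ m) (𝓝[>] 0) (𝓝 1) := by
    simpa [div_pow] using hratio.pow m
  have hquot : Tendsto (fun r => H' r / r) (𝓝[>] 0) (𝓝 (1 / ((m : ℝ) + 1))) := by
    have h := (tendsto_integral_div_pow_succ hcont m hratio_pow).div hratio_pow one_ne_zero
    rw [div_one] at h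
    refine h.congr' ?_
    filter_upwards [self_mem_nhdsWithin] with r (hr : 0 < r)
    have := (hψpos r hr).ne'
    simp only [Pi.div_apply, hH']
    field_simp
    ring
  refine ⟨by simp [hH'], hquot, ?_⟩
  have hlim : Tendsto (fun r => 1 - m * (H' r / r / (ψ r / r) * derivWithin ψ (Ici 0) r))
      (𝓝[>] 0) (𝓝 (1 / ((m : ℝ) + 1))) := by
    have h := (((hquot.div hratio one_ne_zero).mul hderiv_lim).const_mul (m : ℝ)).const_sub 1
    have hval : 1 - (m : ℝ) * (1 / ((m : ℝ) + 1) / 1 * 1) = 1 / ((m : ℝ) + 1) := by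
      field_simp
      ring
    rwa [hval] at h
  refine hlim.congr' ?_
  filter_upwards [self_mem_nhdsWithin] with r (hr : 0 < r)
  have hne := (hψpos r hr).ne'
  have h := (hasDerivAt_integral_of_continuousOn_Ici_s5 hcont hr).fun_div ((hderiv r hr).fun_pow m)
    (pow_ne_zero m hne)
  rw [funext hH', h.deriv]
  rcases m with _ | k
  · simp
  · simp only [Nat.add_sub_cancel]
    field_simp
    ring
end

section
/- Let m ∈ (0,1). Then for all real numbers a, b one has 2^{m−1}·|a^m − b^m| ≤ |a − b|^m, where x^m := sign(x)·|x|^m denotes the odd power function. -/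
theorem sign_mul_abs_rpow_of_nonneg {m a : ℝ} (hm : m ≠ 0) (ha : 0 ≤ a) :
    Real.sign a * |a| ^ m = a ^ m := by
  rcases ha.eq_or_lt with rfl | h
  · simp [Real.zero_rpow hm]
  · rw [Real.sign_of_pos h, abs_of_pos h, one_mul]

theorem sign_mul_abs_rpow_neg (m a : ℝ) :
    Real.sign (-a) * |-a| ^ m = -(Real.sign a * |a| ^ m) := by
  rw [Real.sign_neg, abs_neg, neg_mul]

theorem rpow_sub_rpow_le_rpow_sub {m x y : ℝ} (hm₀ : 0 ≤ m) (hm₁ : m ≤ 1) (hy : 0 ≤ y)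
    (hyx : y ≤ x) : x ^ m - y ^ m ≤ (x - y) ^ m := by
  have h := NNReal.rpow_add_le_add_rpow ⟨x - y, sub_nonneg.2 hyx⟩ ⟨y, hy⟩ hm₀ hm₁
  have h' : (x - y + y) ^ m ≤ (x - y) ^ m + y ^ m := by exact_mod_cast h
  rw [sub_add_cancel] at h'
  linarith

theorem abs_rpow_sub_rpow_le {m x y : ℝ} (hm₀ : 0 ≤ m) (hm₁ : m ≤ 1) (hx : 0 ≤ x) (hy : 0 ≤ y) :
    |x ^ m - y ^ m| ≤ |x - y| ^ m := by
  wlog h : y ≤ x generalizing x y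
  · rw [abs_sub_comm, abs_sub_comm x]
    exact this hy hx (le_of_not_ge h)
  rw [abs_of_nonneg (sub_nonneg.2 (Real.rpow_le_rpow hy h hm₀)), abs_of_nonneg (sub_nonneg.2 h)]
  exact rpow_sub_rpow_le_rpow_sub hm₀ hm₁ hy h

theorem two_rpow_mul_rpow_add_rpow_le {m x y : ℝ} (hm₀ : 0 ≤ m) (hm₁ : m ≤ 1) (hx : 0 ≤ x)
    (hy : 0 ≤ y) : (2 : ℝ) ^ (m - 1) * (x ^ m + y ^ m) ≤ (x + y) ^ m := by
  have h := (Real.concaveOn_rpow hm₀ hm₁).2 (Set.mem_Ici.2 hx) (Set.mem_Ici.2 hy)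
    (by norm_num : (0 : ℝ) ≤ 1 / 2) (by norm_num : (0 : ℝ) ≤ 1 / 2) (by norm_num)
  simp only [smul_eq_mul] at h
  have h2 : (0 : ℝ) < 2 ^ m := by positivity
  rw [show 1 / 2 * x + 1 / 2 * y = (x + y) / 2 by ring,
    Real.div_rpow (by positivity) (by norm_num), le_div_iff₀ h2] at h
  rw [Real.rpow_sub_one (by norm_num)]
  linarith

theorem stmt_7 (m : ℝ) (hm : m ∈ Set.Ioo (0:ℝ) 1) (a b : ℝ) :
    (2:ℝ) ^ (m - 1) * |Real.sign a * |a| ^ m - Real.sign b * |b| ^ m| ≤ |a - b| ^ m := by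
  obtain ⟨hm₀, hm₁⟩ := hm
  wlog ha : 0 ≤ a generalizing a b
  · have h := this (-a) (-b) (by linarith)
    rwa [sign_mul_abs_rpow_neg, sign_mul_abs_rpow_neg, neg_sub_neg, neg_sub_neg, abs_sub_comm,
      abs_sub_comm b] at h
  rw [sign_mul_abs_rpow_of_nonneg hm₀.ne' ha]
  rcases le_total 0 b with hb | hb
  · rw [sign_mul_abs_rpow_of_nonneg hm₀.ne' hb]
    have h2 : (2 : ℝ) ^ (m - 1) ≤ 1 :=
      Real.rpow_le_one_of_one_le_of_nonpos (by norm_num) (by linarith)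
    exact (mul_le_of_le_one_left (abs_nonneg _) h2).trans
      (abs_rpow_sub_rpow_le hm₀.le hm₁.le ha hb)
  · obtain ⟨c, rfl⟩ : ∃ c, b = -c := ⟨-b, by ring⟩
    have hc : 0 ≤ c := by linarith
    rw [sign_mul_abs_rpow_neg, sign_mul_abs_rpow_of_nonneg hm₀.ne' hc, sub_neg_eq_add,
      sub_neg_eq_add, abs_of_nonneg (by positivity), abs_of_nonneg (by positivity)]
    exact two_rpow_mul_rpow_add_rpow_le hm₀.le hm₁.le ha hc
end

section
/- Let n ≥ 1 and m ∈ (0,1). Let u, v be classical solutions of the fast diffusion equation on ℝⁿ × (0,∞) with v(x,t) ≤ u(x,t) for all (x,t). Let ψ : ℝⁿ → ℝ be a C² nonnegative function whose support is contained in a compact set K, and let B ≥ 0 satisfy |Δψ(x)| ≤ B·ψ(x)^m for every x ∈ ℝⁿ. Then for all 0 < s ≤ t, setting y(τ) := ∫_{ℝⁿ} (u(x,τ) − v(x,τ))·ψ(x) dx, one has y(t)^{1−m} ≤ y(s)^{1−m} + (1−m)·2^{1−m}·B·λ(K)^{1−m}·(t−s), where λ denotes Lebesgue measure. -/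
open MeasureTheory

/-- The Euclidean Laplacian: trace of the second derivative, computed as the sum of the
second directional derivatives along the standard orthonormal basis. -/
noncomputable def laplacian {n : ℕ} (f : EuclideanSpace ℝ (Fin n) → ℝ)
    (x : EuclideanSpace ℝ (Fin n)) : ℝ :=
  ∑ i : Fin n,
    fderiv ℝ (fun y => fderiv ℝ f y (EuclideanSpace.single i 1)) x (EuclideanSpace.single i 1)

section helpers

variable {n : ℕ}

lemma ContDiff.fderiv_apply_const {k : ℕ} {f : EuclideanSpace ℝ (Fin n) → ℝ}
    (hf : ContDiff ℝ (k + 1 : ℕ) f) (e : EuclideanSpace ℝ (Fin n)) :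
    ContDiff ℝ k (fun y => fderiv ℝ f y e) :=
  (hf.fderiv_right (by norm_cast)).clm_apply contDiff_const

lemma integral_fderiv_apply_mul {f g : EuclideanSpace ℝ (Fin n) → ℝ}
    (hf : ContDiff ℝ 1 f) (hg : ContDiff ℝ 1 g) (hgc : HasCompactSupport g)
    (e : EuclideanSpace ℝ (Fin n)) :
    ∫ x, fderiv ℝ f x e * g x = - ∫ x, f x * fderiv ℝ g x e := by
  have hf' : Continuous fun y => fderiv ℝ f y e :=
    (hf.continuous_fderiv one_ne_zero).clm_apply continuous_const
  have hg' : Continuous fun y => fderiv ℝ g y e :=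
    (hg.continuous_fderiv one_ne_zero).clm_apply continuous_const
  have hgc' : HasCompactSupport fun y => fderiv ℝ g y e := hgc.fderiv_apply (𝕜 := ℝ) e
  rw [integral_mul_fderiv_eq_neg_fderiv_mul_of_integrable, neg_neg]
  · exact (hf'.mul hg.continuous).integrable_of_hasCompactSupport hgc.mul_left
  · exact (hf.continuous.mul hg').integrable_of_hasCompactSupport hgc'.mul_left
  · exact (hf.continuous.mul hg.continuous).integrable_of_hasCompactSupport hgc.mul_left
  · exact fun x _ => hf.differentiable one_ne_zero x
  · exact fun x _ => hg.differentiable one_ne_zero x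

lemma continuous_laplacian {f : EuclideanSpace ℝ (Fin n) → ℝ} (hf : ContDiff ℝ 2 f) :
    Continuous (laplacian f) := by
  refine continuous_finsetSum _ fun i _ => ?_
  exact ((ContDiff.fderiv_apply_const (k := 1) hf _).fderiv_apply_const (k := 0) _).continuous

/-- Green's second identity against a compactly supported test function. -/
lemma integral_laplacian_mul {f g : EuclideanSpace ℝ (Fin n) → ℝ}
    (hf : ContDiff ℝ 2 f) (hg : ContDiff ℝ 2 g) (hgc : HasCompactSupport g) :
    ∫ x, laplacian f x * g x = ∫ x, f x * laplacian g x := by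
  simp only [laplacian, Finset.sum_mul, Finset.mul_sum]
  rw [integral_finsetSum, integral_finsetSum]
  · refine Finset.sum_congr rfl fun i _ => ?_
    have hf1 := ContDiff.fderiv_apply_const (k := 1) hf (EuclideanSpace.single i 1)
    have hg1 := ContDiff.fderiv_apply_const (k := 1) hg (EuclideanSpace.single i 1)
    have hgc1 : HasCompactSupport fun y => fderiv ℝ g y (EuclideanSpace.single i 1) :=
      hgc.fderiv_apply (𝕜 := ℝ) _
    rw [integral_fderiv_apply_mul hf1 (hg.of_le (by norm_num)) hgc,
      integral_fderiv_apply_mul (hf.of_le (by norm_num)) hg1 hgc1, neg_neg]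
  · intro i _
    have hg1 := ContDiff.fderiv_apply_const (k := 1) hg (EuclideanSpace.single i 1)
    have hg2 := hg1.fderiv_apply_const (k := 0) (EuclideanSpace.single i 1)
    have hgc1 : HasCompactSupport fun y => fderiv ℝ g y (EuclideanSpace.single i 1) :=
      hgc.fderiv_apply (𝕜 := ℝ) _
    refine (hf.continuous.mul hg2.continuous).integrable_of_hasCompactSupport ?_
    exact (hgc1.fderiv_apply (𝕜 := ℝ) _).mul_left
  · intro i _
    have hf1 := ContDiff.fderiv_apply_const (k := 1) hf (EuclideanSpace.single i 1)
    have hf2 := hf1.fderiv_apply_const (k := 0) (EuclideanSpace.single i 1)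
    exact (hf2.continuous.mul hg.continuous).integrable_of_hasCompactSupport hgc.mul_left

/-- Differentiation under the integral sign for a jointly `C¹` integrand cut off by a compactly
supported continuous weight. -/
lemma hasDerivAt_integral_mul_of_contDiffOn {w : EuclideanSpace ℝ (Fin n) → ℝ → ℝ}
    {d : EuclideanSpace ℝ (Fin n) → ℝ → ℝ} {ψ : EuclideanSpace ℝ (Fin n) → ℝ}
    (hw : ContDiffOn ℝ 1 (fun q : EuclideanSpace ℝ (Fin n) × ℝ => w q.1 q.2)
      (Set.univ ×ˢ Set.Ioi 0))
    (hd : ∀ x, ∀ t > (0 : ℝ), HasDerivAt (w x) (d x t) t)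
    (hψ : Continuous ψ) (hψc : HasCompactSupport ψ) {t : ℝ} (ht : 0 < t) :
    HasDerivAt (fun τ => ∫ x, w x τ * ψ x) (∫ x, d x t * ψ x) t := by
  set U : Set (EuclideanSpace ℝ (Fin n) × ℝ) := Set.univ ×ˢ Set.Ioi 0
  have hU : IsOpen U := isOpen_univ.prod isOpen_Ioi
  have hdc : ContinuousOn (fun q : EuclideanSpace ℝ (Fin n) × ℝ => d q.1 q.2) U := by
    have h1 : ContinuousOn (fun q => fderiv ℝ
        (fun q : EuclideanSpace ℝ (Fin n) × ℝ => w q.1 q.2) q (0, 1)) U :=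
      (hw.continuousOn_fderiv_of_isOpen hU le_rfl).clm_apply continuousOn_const
    refine h1.congr fun q hq => ?_
    have hq2 : 0 < q.2 := hq.2
    have h2 := ((hw.differentiableOn one_ne_zero).differentiableAt (hU.mem_nhds hq)).hasFDerivAt
    have h3 : HasDerivAt (fun τ : ℝ => (q.1, τ)) ((0 : EuclideanSpace ℝ (Fin n)), (1 : ℝ)) q.2 :=
      (hasDerivAt_const _ _).prodMk (hasDerivAt_id _)
    have h4 : HasDerivAt (w q.1) (fderiv ℝ
        (fun q : EuclideanSpace ℝ (Fin n) × ℝ => w q.1 q.2) q (0, 1)) q.2 :=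
      HasFDerivAt.comp_hasDerivAt (f := fun τ : ℝ => (q.1, τ)) q.2 h2 h3
    exact (hd q.1 q.2 hq2).unique h4
  have hslice {g : EuclideanSpace ℝ (Fin n) → ℝ → ℝ}
      (hg : ContinuousOn (fun q : EuclideanSpace ℝ (Fin n) × ℝ => g q.1 q.2) U)
      {τ : ℝ} (hτ : 0 < τ) : Continuous fun x => g x τ :=
    hg.comp_continuous (f := fun x => (x, τ)) (by fun_prop) fun x => ⟨trivial, hτ⟩
  obtain ⟨C, hC⟩ := (hψc.isCompact.prod
    (isCompact_Icc (a := t / 2) (b := 2 * t))).exists_bound_of_continuousOn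
    (hdc.mono fun q hq => ⟨trivial, lt_of_lt_of_le (half_pos ht) hq.2.1⟩)
  have hpos : ∀ τ ∈ Set.Icc (t / 2) (2 * t), 0 < τ := fun τ hτ => (half_pos ht).trans_le hτ.1
  have hmul_int {g : EuclideanSpace ℝ (Fin n) → ℝ} (hg : Continuous g) :
      Integrable fun x => g x * ψ x :=
    (hg.mul hψ).integrable_of_hasCompactSupport hψc.mul_left
  refine (hasDerivAt_integral_of_dominated_loc_of_deriv_le (s := Set.Icc (t / 2) (2 * t))
    (F := fun τ x => w x τ * ψ x) (F' := fun τ x => d x τ * ψ x) (bound := fun x => C * |ψ x|)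
    (Icc_mem_nhds (by linarith) (by linarith)) ?_ (hmul_int (hslice hw.continuousOn ht))
    (hmul_int (hslice hdc ht)).aestronglyMeasurable ?_ ?_ ?_).2
  · filter_upwards [lt_mem_nhds ht] with τ hτ
    exact (hmul_int (hslice hw.continuousOn hτ)).aestronglyMeasurable
  · refine Filter.Eventually.of_forall fun x τ hτ => ?_
    rw [norm_mul, Real.norm_eq_abs (ψ x)]
    by_cases hx : x ∈ tsupport ψ
    · exact mul_le_mul_of_nonneg_right (hC (x, τ) ⟨hx, hτ⟩) (abs_nonneg _)
    · simp [image_eq_zero_of_notMem_tsupport hx]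
  · exact (hψ.integrable_of_hasCompactSupport hψc).abs.const_mul C
  · exact Filter.Eventually.of_forall fun x τ hτ => (hd x τ (hpos τ hτ)).mul_const _

/-- Hölder's inequality for the concave power `m` of a function supported in a compact set. -/
lemma integral_rpow_le_of_support_subset {m : ℝ} (hm : m ∈ Set.Ioo (0 : ℝ) 1)
    {g : EuclideanSpace ℝ (Fin n) → ℝ} (hg : Continuous g) (hg0 : ∀ x, 0 ≤ g x)
    {K : Set (EuclideanSpace ℝ (Fin n))} (hK : IsCompact K) (hgK : Function.support g ⊆ K) :
    ∫ x, g x ^ m ≤ (volume K).toReal ^ (1 - m) * (∫ x, g x) ^ m := by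
  have hm0 := hm.1
  have hm1 : 0 < 1 - m := sub_pos.2 hm.2
  have hgm : Continuous fun x => g x ^ m := hg.rpow_const fun _ => Or.inr hm0.le
  have : IsFiniteMeasure (volume.restrict K) := ⟨by simpa using hK.measure_lt_top⟩
  have h1 : ∫ x, g x = ∫ x in K, g x := (setIntegral_eq_integral_of_forall_compl_eq_zero
    fun x hx => Function.notMem_support.1 fun h => hx (hgK h)).symm
  have h2 : ∫ x, g x ^ m = ∫ x in K, g x ^ m := (setIntegral_eq_integral_of_forall_compl_eq_zero
    fun x hx => by rw [Function.notMem_support.1 fun h => hx (hgK h), Real.zero_rpow hm0.ne']).symm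
  have hpq : (m⁻¹).HolderConjugate ((1 - m)⁻¹) := by
    rw [Real.holderConjugate_iff]
    exact ⟨(one_lt_inv₀ hm0).2 hm.2, by simp⟩
  obtain ⟨C, hC⟩ := hK.exists_bound_of_continuousOn hgm.continuousOn
  have h3 := integral_mul_le_Lp_mul_Lq_of_nonneg (μ := volume.restrict K) hpq
    (f := fun x => g x ^ m) (g := fun _ => (1 : ℝ))
    (Filter.Eventually.of_forall fun x => Real.rpow_nonneg (hg0 x) m)
    (Filter.Eventually.of_forall fun x => zero_le_one)
    (MemLp.of_bound hgm.aestronglyMeasurable C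
      ((ae_restrict_iff' hK.measurableSet).2 (Filter.Eventually.of_forall hC)))
    (memLp_const 1)
  have h4 : ∀ x, (g x ^ m) ^ m⁻¹ = g x := fun x => Real.rpow_rpow_inv (hg0 x) hm0.ne'
  simp only [mul_one, h4, Real.one_rpow, one_div, inv_inv, integral_const, smul_eq_mul,
    measureReal_restrict_apply_univ] at h3
  rw [h1, h2, mul_comm]
  exact h3

end helpers

lemma rpow_sub_rpow_le {m a b : ℝ} (hm : m ∈ Set.Ioo (0 : ℝ) 1) (hb : 0 ≤ b) (hab : b ≤ a) :
    a ^ m - b ^ m ≤ (a - b) ^ m := by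
  have := Real.rpow_add_le_add_rpow (sub_nonneg.2 hab) hb hm.1.le hm.2.le
  rw [sub_add_cancel] at this
  linarith

/-- Integration of the differential inequality `y' ≤ C y ^ m` for nonnegative `y`. -/
lemma rpow_one_sub_le_of_deriv_le {m C s t : ℝ} {y y' : ℝ → ℝ} (hm : m ∈ Set.Ioo (0 : ℝ) 1)
    (hC : 0 ≤ C) (hst : s ≤ t) (hy0 : ∀ τ ∈ Set.Icc s t, 0 ≤ y τ)
    (hy : ∀ τ ∈ Set.Icc s t, HasDerivAt y (y' τ) τ)
    (hy' : ∀ τ ∈ Set.Icc s t, y' τ ≤ C * y τ ^ m) :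
    y t ^ (1 - m) ≤ y s ^ (1 - m) + (1 - m) * C * (t - s) := by
  have hm1 : 0 < 1 - m := sub_pos.2 hm.2
  have key : ∀ ε > 0, (y t + ε) ^ (1 - m) ≤ (y s + ε) ^ (1 - m) + (1 - m) * C * (t - s) := by
    intro ε hε
    have hd : ∀ τ ∈ Set.Icc s t, HasDerivAt (fun τ => (y τ + ε) ^ (1 - m) - (1 - m) * C * τ)
        (y' τ * (1 - m) * (y τ + ε) ^ (1 - m - 1) - (1 - m) * C * 1) τ := fun τ hτ =>
      (((hy τ hτ).add_const ε).rpow_const (Or.inl (by linarith [hy0 τ hτ]))).sub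
        ((hasDerivAt_id τ).const_mul _)
    have hanti : AntitoneOn (fun τ => (y τ + ε) ^ (1 - m) - (1 - m) * C * τ) (Set.Icc s t) := by
      refine antitoneOn_of_hasDerivWithinAt_nonpos (convex_Icc s t)
        (fun τ hτ => (hd τ hτ).continuousAt.continuousWithinAt)
        (fun τ hτ => (hd τ (interior_subset hτ)).hasDerivWithinAt) fun τ hτ => ?_
      have hτ' := interior_subset hτ
      have hpos : 0 < y τ + ε := by linarith [hy0 τ hτ']
      have h1 : y' τ ≤ C * (y τ + ε) ^ m := (hy' τ hτ').trans <|
        mul_le_mul_of_nonneg_left (Real.rpow_le_rpow (hy0 τ hτ') (by linarith) hm.1.le) hC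
      have h2 : y' τ * (y τ + ε) ^ (-m) ≤ C := by
        refine (mul_le_mul_of_nonneg_right h1 (Real.rpow_nonneg hpos.le _)).trans_eq ?_
        rw [mul_assoc, ← Real.rpow_add hpos, add_neg_cancel, Real.rpow_zero, mul_one]
      have h3 : (1 : ℝ) - m - 1 = -m := by ring
      rw [h3]
      nlinarith
    have := hanti (Set.left_mem_Icc.2 hst) (Set.right_mem_Icc.2 hst) hst
    simp only at this
    linarith
  have hlim : ∀ a : ℝ, Filter.Tendsto (fun ε : ℝ => (a + ε) ^ (1 - m)) (nhdsWithin 0 (Set.Ioi 0))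
      (nhds (a ^ (1 - m))) := fun a => by
    have : Continuous fun ε : ℝ => (a + ε) ^ (1 - m) :=
      (continuous_const.add continuous_id).rpow_const fun _ => Or.inr hm1.le
    simpa using (this.tendsto 0).mono_left nhdsWithin_le_nhds
  exact le_of_tendsto_of_tendsto (hlim _) ((hlim _).add_const _)
    (Filter.eventually_of_mem self_mem_nhdsWithin key)

theorem stmt_10 (n : ℕ) (hn : 1 ≤ n) (m : ℝ) (hm : m ∈ Set.Ioo (0:ℝ) 1)
    (u v : EuclideanSpace ℝ (Fin n) → ℝ → ℝ)
    (hu_pos : ∀ x, ∀ t > (0:ℝ), 0 < u x t)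
    (hv_pos : ∀ x, ∀ t > (0:ℝ), 0 < v x t)
    (hu_smooth : ContDiffOn ℝ (⊤ : ℕ∞) (fun q : EuclideanSpace ℝ (Fin n) × ℝ => u q.1 q.2)
      (Set.univ ×ˢ Set.Ioi 0))
    (hv_smooth : ContDiffOn ℝ (⊤ : ℕ∞) (fun q : EuclideanSpace ℝ (Fin n) × ℝ => v q.1 q.2)
      (Set.univ ×ˢ Set.Ioi 0))
    (hu_eq : ∀ x, ∀ t > (0:ℝ),
      HasDerivAt (fun τ => u x τ) (laplacian (fun y => u y t ^ m) x) t)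
    (hv_eq : ∀ x, ∀ t > (0:ℝ),
      HasDerivAt (fun τ => v x τ) (laplacian (fun y => v y t ^ m) x) t)
    (hvu : ∀ x, ∀ t > (0:ℝ), v x t ≤ u x t)
    (ψ : EuclideanSpace ℝ (Fin n) → ℝ) (hψ : ContDiff ℝ 2 ψ)
    (hψ0 : ∀ x, 0 ≤ ψ x)
    (K : Set (EuclideanSpace ℝ (Fin n))) (hK : IsCompact K)
    (hsupp : Function.support ψ ⊆ K)
    (B : ℝ) (hB : 0 ≤ B)
    (hΔψ : ∀ x, |laplacian ψ x| ≤ B * ψ x ^ m)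
    (s t : ℝ) (hs : 0 < s) (hst : s ≤ t) :
    (∫ x, (u x t - v x t) * ψ x) ^ (1 - m) ≤
      (∫ x, (u x s - v x s) * ψ x) ^ (1 - m) +
        (1 - m) * 2 ^ (1 - m) * B * (volume K).toReal ^ (1 - m) * (t - s) := by
  have hm0 := hm.1
  have hψc : HasCompactSupport ψ := HasCompactSupport.intro hK fun x hx =>
    Function.notMem_support.1 fun h => hx (hsupp h)
  have hslice {w : EuclideanSpace ℝ (Fin n) → ℝ → ℝ}
      (hw : ContDiffOn ℝ (⊤ : ℕ∞) (fun q : EuclideanSpace ℝ (Fin n) × ℝ => w q.1 q.2)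
        (Set.univ ×ˢ Set.Ioi 0)) {τ : ℝ} (hτ : 0 < τ) : ContDiff ℝ 2 fun x => w x τ := by
    have h : ContDiff ℝ (⊤ : ℕ∞) fun x => w x τ :=
      hw.comp_contDiff (f := fun x => (x, τ)) (by fun_prop) fun x => ⟨trivial, hτ⟩
    exact h.of_le (WithTop.coe_le_coe.2 (le_top : (2 : ℕ∞) ≤ ⊤))
  have hmul_int {g : EuclideanSpace ℝ (Fin n) → ℝ} (hg : Continuous g) :
      Integrable fun x => g x * ψ x :=
    (hg.mul hψ.continuous).integrable_of_hasCompactSupport hψc.mul_left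
  set y : ℝ → ℝ := fun τ => ∫ x, (u x τ - v x τ) * ψ x with hy_def
  set y' : ℝ → ℝ := fun τ => ∫ x, (laplacian (fun z => u z τ ^ m) x -
    laplacian (fun z => v z τ ^ m) x) * ψ x with hy'_def
  have hy0 : ∀ τ > 0, 0 ≤ y τ := fun τ hτ =>
    integral_nonneg fun x => mul_nonneg (sub_nonneg.2 (hvu x τ hτ)) (hψ0 x)
  have hderiv : ∀ τ > 0, HasDerivAt y (y' τ) τ := fun τ hτ =>
    hasDerivAt_integral_mul_of_contDiffOn (w := fun x τ => u x τ - v x τ)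
      (d := fun x τ => laplacian (fun z => u z τ ^ m) x - laplacian (fun z => v z τ ^ m) x)
      ((hu_smooth.sub hv_smooth).of_le (by exact_mod_cast (le_top : (1 : ℕ∞) ≤ ⊤)))
      (fun x r hr => (hu_eq x r hr).sub (hv_eq x r hr)) hψ.continuous hψc hτ
  have hbound : ∀ τ > 0, y' τ ≤ B * (volume K).toReal ^ (1 - m) * y τ ^ m := by
    intro τ hτ
    have hu := hslice hu_smooth hτ
    have hv := hslice hv_smooth hτ
    have hum : ContDiff ℝ 2 fun x => u x τ ^ m :=
      hu.rpow_const_of_ne fun x => (hu_pos x τ hτ).ne'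
    have hvm : ContDiff ℝ 2 fun x => v x τ ^ m :=
      hv.rpow_const_of_ne fun x => (hv_pos x τ hτ).ne'
    have hΔc : HasCompactSupport (laplacian ψ) := HasCompactSupport.intro hK fun x hx => by
      have h0 : ψ x = 0 := Function.notMem_support.1 fun h => hx (hsupp h)
      have h1 := hΔψ x
      rw [h0, Real.zero_rpow hm0.ne', mul_zero] at h1
      exact abs_nonpos_iff.1 h1
    have hmul_intΔ {g : EuclideanSpace ℝ (Fin n) → ℝ} (hg : Continuous g) :
        Integrable fun x => g x * laplacian ψ x :=
      (hg.mul (continuous_laplacian hψ)).integrable_of_hasCompactSupport hΔc.mul_left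
    have hgreen : y' τ = ∫ x, (u x τ ^ m - v x τ ^ m) * laplacian ψ x := by
      simp only [hy'_def, sub_mul]
      rw [integral_sub (hmul_int (continuous_laplacian hum)) (hmul_int (continuous_laplacian hvm)),
        integral_laplacian_mul hum hψ hψc, integral_laplacian_mul hvm hψ hψc,
        integral_sub (hmul_intΔ hum.continuous) (hmul_intΔ hvm.continuous)]
    have hgc : Continuous fun x => (u x τ - v x τ) * ψ x :=
      (hu.continuous.sub hv.continuous).mul hψ.continuous
    have hgm : Integrable fun x => ((u x τ - v x τ) * ψ x) ^ m :=
      (hgc.rpow_const fun _ => Or.inr hm0.le).integrable_of_hasCompactSupport <|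
        HasCompactSupport.intro hψc.isCompact fun x hx => by
          rw [image_eq_zero_of_notMem_tsupport hx, mul_zero, Real.zero_rpow hm0.ne']
    calc y' τ = ∫ x, (u x τ ^ m - v x τ ^ m) * laplacian ψ x := hgreen
      _ ≤ ∫ x, B * ((u x τ - v x τ) * ψ x) ^ m := by
        refine integral_mono ?_ (hgm.const_mul B) fun x => ?_
        · exact hmul_intΔ (hum.continuous.sub hvm.continuous)
        · have huv := hvu x τ hτ
          have hv0 := (hv_pos x τ hτ).le
          calc (u x τ ^ m - v x τ ^ m) * laplacian ψ x
              ≤ (u x τ - v x τ) ^ m * (B * ψ x ^ m) :=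
                mul_le_mul_of_nonneg (rpow_sub_rpow_le hm hv0 huv)
                  ((le_abs_self _).trans (hΔψ x))
                  (sub_nonneg.2 (Real.rpow_le_rpow hv0 huv hm0.le))
                  (mul_nonneg hB (Real.rpow_nonneg (hψ0 x) m))
            _ = B * ((u x τ - v x τ) * ψ x) ^ m := by
                rw [Real.mul_rpow (sub_nonneg.2 huv) (hψ0 x)]
                ring
      _ = B * ∫ x, ((u x τ - v x τ) * ψ x) ^ m := integral_const_mul _ _
      _ ≤ B * ((volume K).toReal ^ (1 - m) * y τ ^ m) := by
        refine mul_le_mul_of_nonneg_left (integral_rpow_le_of_support_subset hm hgc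
          (fun x => mul_nonneg (sub_nonneg.2 (hvu x τ hτ)) (hψ0 x)) hK ?_) hB
        exact (Function.support_mul_subset_right _ _).trans hsupp
      _ = B * (volume K).toReal ^ (1 - m) * y τ ^ m := by ring
  have hpos : ∀ τ ∈ Set.Icc s t, 0 < τ := fun τ hτ => hs.trans_le hτ.1
  have hC : 0 ≤ B * (volume K).toReal ^ (1 - m) :=
    mul_nonneg hB (Real.rpow_nonneg ENNReal.toReal_nonneg _)
  have hmain := rpow_one_sub_le_of_deriv_le hm hC hst (fun τ hτ => hy0 τ (hpos τ hτ))
    (fun τ hτ => hderiv τ (hpos τ hτ)) (fun τ hτ => hbound τ (hpos τ hτ))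
  have h2 : (1 : ℝ) ≤ 2 ^ (1 - m) := Real.one_le_rpow one_le_two (sub_pos.2 hm.2).le
  have hD : 0 ≤ (1 - m) * (B * (volume K).toReal ^ (1 - m)) * (t - s) :=
    mul_nonneg (mul_nonneg (sub_pos.2 hm.2).le hC) (sub_nonneg.2 hst)
  refine hmain.trans (add_le_add_right ?_ _)
  calc (1 - m) * (B * (volume K).toReal ^ (1 - m)) * (t - s)
      ≤ 2 ^ (1 - m) * ((1 - m) * (B * (volume K).toReal ^ (1 - m)) * (t - s)) :=
        le_mul_of_one_le_left hD h2
    _ = (1 - m) * 2 ^ (1 - m) * B * (volume K).toReal ^ (1 - m) * (t - s) := by ring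
end

section
/- Let n ≥ 1, p > 1 and α > 0. Let W : ℝⁿ → ℝ be a C² function with W(x) ≥ 0 for all x, satisfying the differential inequality ΔW(x) ≥ α·W(x)^p for every x ∈ ℝⁿ. Then W is identically zero. -/
open Filter Topology

/-- The second-order necessary condition at a local maximum of a function of one variable. -/
theorem IsLocalMax.secondDeriv_nonpos {u v : ℝ → ℝ} {a c : ℝ} (hmax : IsLocalMax u a)
    (hu : ∀ᶠ t in 𝓝 a, HasDerivAt u (v t) t) (hv : HasDerivAt v c a) : c ≤ 0 := by
  by_contra! hc
  have hderiv : deriv u =ᶠ[𝓝 a] v := hu.mono fun t ht => ht.deriv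
  have hsecond : deriv (deriv u) a = c := hderiv.deriv_eq.trans hv.deriv
  have hmin : IsLocalMin u a :=
    isLocalMin_of_deriv_deriv_pos (hsecond ▸ hc) hmax.deriv_eq_zero
      hu.self_of_nhds.continuousAt
  have hconst : u =ᶠ[𝓝 a] fun _ => u a := by
    filter_upwards [hmax, hmin] with t h₁ h₂ using le_antisymm h₁ h₂
  have hzero : deriv u =ᶠ[𝓝 a] fun _ => 0 := by
    simpa using hconst.deriv
  have : deriv (deriv u) a = 0 := by simpa using hzero.deriv_eq
  linarith

/-- At a point where `W` is touched from above by the barrier `M * (R ^ 2 - ‖z - x₀‖ ^ 2) ^ (-k)`,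
the second directional derivative of `W` is at most that of the barrier. -/
theorem secondDirectionalDeriv_le_of_barrier {E : Type*} [NormedAddCommGroup E]
    [InnerProductSpace ℝ E] {W : E → ℝ} (hW : ContDiff ℝ 2 W) {x₀ y e : E} (he : ‖e‖ = 1)
    {R k M : ℝ} (hy : 0 < R ^ 2 - ‖y - x₀‖ ^ 2)
    (heq : W y = M * (R ^ 2 - ‖y - x₀‖ ^ 2) ^ (-k))
    (hle : ∀ z, 0 < R ^ 2 - ‖z - x₀‖ ^ 2 → W z ≤ M * (R ^ 2 - ‖z - x₀‖ ^ 2) ^ (-k)) :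
    fderiv ℝ (fun z => fderiv ℝ W z e) y e ≤
      M * (4 * k * (k + 1) * (R ^ 2 - ‖y - x₀‖ ^ 2) ^ (-k - 2) * inner ℝ (y - x₀) e ^ 2
        + 2 * k * (R ^ 2 - ‖y - x₀‖ ^ 2) ^ (-k - 1)) := by
  set h := R ^ 2 - ‖y - x₀‖ ^ 2 with hh
  set b := inner ℝ (y - x₀) e with hb
  have hline : ∀ t : ℝ, HasDerivAt (fun s : ℝ => y + s • e) e t := fun t => by
    simpa using ((hasDerivAt_id t).smul_const e).const_add y
  have hquad : ∀ t : ℝ, R ^ 2 - ‖y + t • e - x₀‖ ^ 2 = h - 2 * t * b - t ^ 2 := fun t => by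
    rw [show y + t • e - x₀ = (y - x₀) + t • e by abel, norm_add_sq_real, norm_smul, he,
      inner_smul_right, Real.norm_eq_abs, mul_one, sq_abs]
    ring
  have hq : ∀ t : ℝ, HasDerivAt (fun s : ℝ => h - 2 * s * b - s ^ 2) (-2 * b - 2 * t) t :=
    fun t => by
      have := ((((hasDerivAt_id t).const_mul 2).mul_const b).const_sub h).sub
        ((hasDerivAt_id t).pow 2)
      refine this.congr_deriv ?_
      simp
  have hpos : ∀ᶠ t : ℝ in 𝓝 0, 0 < h - 2 * t * b - t ^ 2 :=
    (hq 0).continuousAt.eventually (lt_mem_nhds (by simpa using hy))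
  have hdW : Differentiable ℝ W := hW.differentiable (by norm_num)
  have hd2W : Differentiable ℝ fun z => fderiv ℝ W z e :=
    ((hW.fderiv_right (m := 1) (by norm_num)).differentiable (by norm_num)).clm_apply
      (differentiable_const e)
  have hmax : IsLocalMax (fun t : ℝ => W (y + t • e) - M * (h - 2 * t * b - t ^ 2) ^ (-k)) 0 := by
    filter_upwards [hpos] with t ht
    have := hle (y + t • e) (by rwa [hquad])
    rw [hquad] at this
    simpa [heq] using this
  have hu : ∀ᶠ t : ℝ in 𝓝 0,
      HasDerivAt (fun t : ℝ => W (y + t • e) - M * (h - 2 * t * b - t ^ 2) ^ (-k))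
        (fderiv ℝ W (y + t • e) e
          - M * ((-2 * b - 2 * t) * (-k) * (h - 2 * t * b - t ^ 2) ^ (-k - 1))) t := by
    filter_upwards [hpos] with t ht
    exact ((hdW _).hasFDerivAt.comp_hasDerivAt t (hline t)).sub
      (((hq t).rpow_const (Or.inl ht.ne')).const_mul M)
  have hv : HasDerivAt (fun t : ℝ => fderiv ℝ W (y + t • e) e
          - M * ((-2 * b - 2 * t) * (-k) * (h - 2 * t * b - t ^ 2) ^ (-k - 1)))
        (fderiv ℝ (fun z => fderiv ℝ W z e) y e
          - M * (4 * k * (k + 1) * h ^ (-k - 2) * b ^ 2 + 2 * k * h ^ (-k - 1))) 0 := by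
    have h₁ : HasDerivAt (fun t : ℝ => fderiv ℝ W (y + t • e) e)
        (fderiv ℝ (fun z => fderiv ℝ W z e) y e) 0 := by
      exact ((hd2W (y + (0 : ℝ) • e)).hasFDerivAt.comp_hasDerivAt 0 (hline 0)).congr_deriv
        (by rw [zero_smul, add_zero])
    have h₂ : HasDerivAt (fun t : ℝ => (-2 * b - 2 * t) * (-k)) (2 * k) 0 :=
      ((((hasDerivAt_id (0 : ℝ)).const_mul 2).const_sub (-2 * b)).mul_const (-k)).congr_deriv
        (by ring)
    have h₃ := (hq 0).rpow_const (p := -k - 1) (Or.inl hpos.self_of_nhds.ne')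
    refine (h₁.sub ((h₂.mul h₃).const_mul M)).congr_deriv ?_
    rw [show -k - 1 - 1 = -k - 2 by ring]
    simp only [mul_zero, zero_mul, sub_zero, ne_eq, OfNat.ofNat_ne_zero, not_false_eq_true,
      zero_pow]
    ring
  linarith [hmax.secondDeriv_nonpos hu hv]

/-- The Keller–Osserman interior estimate at the centre of a ball of radius `R`. -/
theorem kellerOsserman_estimate {n : ℕ} {p α R : ℝ} (hp : 1 < p) (hα : 0 < α) (hR : 0 < R)
    {W : EuclideanSpace ℝ (Fin n) → ℝ} (hW : ContDiff ℝ 2 W)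
    (hineq : ∀ x, α * W x ^ p ≤ laplacian W x) {x₀ : EuclideanSpace ℝ (Fin n)}
    (hx₀ : 0 < W x₀) :
    α * W x₀ ^ (p - 1) * R ^ 2 ≤
      4 * (2 / (p - 1)) * (2 / (p - 1) + 1) + 2 * n * (2 / (p - 1)) := by
  have hp' : 0 < p - 1 := sub_pos.2 hp
  set k := 2 / (p - 1) with hk
  have hkpos : 0 < k := by positivity
  have hkp : k * (p - 1) = 2 := by rw [hk]; field_simp
  set C := 4 * k * (k + 1) + 2 * n * k with hC
  obtain ⟨y, hyball, hymax⟩ := (isCompact_closedBall x₀ R).exists_isMaxOn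
    ⟨x₀, Metric.mem_closedBall_self hR.le⟩
    (f := fun z => W z * (R ^ 2 - ‖z - x₀‖ ^ 2) ^ k)
    (hW.continuous.mul ((by fun_prop : Continuous fun z => R ^ 2 - ‖z - x₀‖ ^ 2).rpow_const
      fun _ => Or.inr hkpos.le)).continuousOn
  set h := R ^ 2 - ‖y - x₀‖ ^ 2 with hh
  have hcentre : W x₀ * (R ^ 2) ^ k ≤ W y * h ^ k := by
    simpa using hymax (Metric.mem_closedBall_self hR.le)
  have hMpos : 0 < W y * h ^ k := lt_of_lt_of_le (by positivity) hcentre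
  have hnn : 0 ≤ h := by
    rw [mem_closedBall_iff_norm] at hyball
    nlinarith [norm_nonneg (y - x₀)]
  have hpos : 0 < h := hnn.lt_of_ne fun h0 => by
    rw [← h0, Real.zero_rpow hkpos.ne'] at hMpos
    simp at hMpos
  have hWy : 0 < W y := pos_of_mul_pos_left hMpos (by positivity)
  have heq : W y = W y * h ^ k * h ^ (-k) := by
    rw [mul_assoc, ← Real.rpow_add hpos]; simp
  have hle : ∀ z, 0 < R ^ 2 - ‖z - x₀‖ ^ 2 →
      W z ≤ W y * h ^ k * (R ^ 2 - ‖z - x₀‖ ^ 2) ^ (-k) := fun z hz => by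
    have hmem : z ∈ Metric.closedBall x₀ R := by
      rw [mem_closedBall_iff_norm]
      exact (abs_le_of_sq_le_sq' (by linarith) hR.le).2
    rw [Real.rpow_neg hz.le, ← div_eq_mul_inv, le_div_iff₀ (by positivity)]
    exact hymax hmem
  have hlap : laplacian W y ≤ W y * h ^ k *
      (4 * k * (k + 1) * h ^ (-k - 2) * ‖y - x₀‖ ^ 2 + n * (2 * k * h ^ (-k - 1))) := by
    refine (Finset.sum_le_sum fun i _ => secondDirectionalDeriv_le_of_barrier hW
      (x₀ := x₀) (e := EuclideanSpace.single i 1) (by simp) hpos heq hle).trans_eq ?_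
    rw [← Finset.mul_sum, Finset.sum_add_distrib, ← Finset.mul_sum]
    simp [EuclideanSpace.inner_single_right, EuclideanSpace.real_norm_sq_eq, hh]
  have e₁ : h ^ k * h ^ (-k - 2) * h ^ 2 = 1 := by
    rw [← Real.rpow_two, ← Real.rpow_add hpos, ← Real.rpow_add hpos]
    ring_nf
    exact Real.rpow_zero h
  have e₂ : h ^ k * h ^ (-k - 1) * h = 1 := by
    nth_rewrite 3 [← Real.rpow_one h]
    rw [← Real.rpow_add hpos, ← Real.rpow_add hpos]
    ring_nf
    exact Real.rpow_zero h
  have hbound : α * W y ^ (p - 1) * h ^ 2 ≤ C * R ^ 2 := by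
    have hsplit : W y ^ p = W y * W y ^ (p - 1) := by
      rw [← Real.rpow_one_add' hWy.le (by linarith)]; ring_nf
    have hmul := mul_le_mul_of_nonneg_right ((hineq y).trans hlap) (sq_nonneg h)
    rw [hsplit] at hmul
    have hrhs : W y * h ^ k *
        (4 * k * (k + 1) * h ^ (-k - 2) * ‖y - x₀‖ ^ 2 + n * (2 * k * h ^ (-k - 1))) * h ^ 2 =
        W y * (4 * k * (k + 1) * ‖y - x₀‖ ^ 2 + 2 * n * k * h) := by
      linear_combination W y * (4 * k * (k + 1) * ‖y - x₀‖ ^ 2) * e₁ +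
        W y * (2 * n * k * h) * e₂
    rw [hrhs] at hmul
    have hcancel : α * W y ^ (p - 1) * h ^ 2 ≤
        4 * k * (k + 1) * ‖y - x₀‖ ^ 2 + 2 * n * k * h :=
      le_of_mul_le_mul_left (by linarith) hWy
    have h₁ : 4 * k * (k + 1) * ‖y - x₀‖ ^ 2 ≤ 4 * k * (k + 1) * R ^ 2 := by
      gcongr ?_ * ?_; linarith
    have h₂ : 2 * n * k * h ≤ 2 * n * k * R ^ 2 := by
      gcongr ?_ * ?_; linarith [sq_nonneg ‖y - x₀‖]
    rw [hC]; linarith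
  have hpow : W x₀ ^ (p - 1) * (R ^ 2) ^ 2 ≤ W y ^ (p - 1) * h ^ 2 := by
    have := Real.rpow_le_rpow (by positivity) hcentre hp'.le
    rwa [Real.mul_rpow hx₀.le (by positivity), Real.mul_rpow hWy.le (by positivity),
      ← Real.rpow_mul (by positivity), ← Real.rpow_mul hnn, hkp, Real.rpow_two,
      Real.rpow_two] at this
  refine le_of_mul_le_mul_right (a := R ^ 2) ?_ (by positivity)
  linarith [mul_le_mul_of_nonneg_left hpow hα.le]

theorem stmt_12 (n : ℕ) (hn : 1 ≤ n) (p α : ℝ) (hp : 1 < p) (hα : 0 < α)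
    (W : EuclideanSpace ℝ (Fin n) → ℝ) (hW : ContDiff ℝ 2 W)
    (hW0 : ∀ x, 0 ≤ W x)
    (hineq : ∀ x, α * W x ^ p ≤ laplacian W x) :
    ∀ x, W x = 0 := by
  intro x
  by_contra hx
  have hpos : 0 < W x := (hW0 x).lt_of_ne' hx
  have hc : 0 < α * W x ^ (p - 1) := by positivity
  have hunbounded : Tendsto (fun R : ℝ => α * W x ^ (p - 1) * R ^ 2) atTop atTop :=
    (tendsto_pow_atTop two_ne_zero).const_mul_atTop hc
  obtain ⟨R, hlt, hR⟩ :=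
    ((hunbounded.eventually_gt_atTop _).and (eventually_gt_atTop 0)).exists
  exact hlt.not_ge (kellerOsserman_estimate hp hα hR hW hineq hpos)
end

section
/- Let n ≥ 1, p > 1 and α > 0. Let W : ℝⁿ → ℝ be a C² function satisfying the semilinear equation ΔW(x) = α·W(x)·|W(x)|^{p−1} for every x ∈ ℝⁿ. Then W is identically zero. -/
open Topology in
theorem IsLocalMin.deriv_deriv_nonneg {u : ℝ → ℝ} {x : ℝ} (h : IsLocalMin u x)
    (hc : ContinuousAt u x) : 0 ≤ deriv (deriv u) x := by
  by_contra! hneg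
  have hmax : IsLocalMax u x := isLocalMax_of_deriv_deriv_neg hneg h.deriv_eq_zero hc
  have hconst : u =ᶠ[𝓝 x] fun _ => u x := by
    filter_upwards [h, hmax] with y h₁ h₂ using le_antisymm h₂ h₁
  have hderiv : deriv u =ᶠ[𝓝 x] fun _ => 0 := by simpa using hconst.deriv
  have := hderiv.deriv_eq
  simp at this
  linarith

/-- First derivative of a power of the quadratic `a - 2 * b * t - t ^ 2`. -/
theorem hasDerivAt_quadratic_rpow (a b q t : ℝ) (ht : 0 < a - 2 * b * t - t ^ 2) :
    HasDerivAt (fun s : ℝ => (a - 2 * b * s - s ^ 2) ^ q)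
      ((-2 * b - 2 * t) * q * (a - 2 * b * t - t ^ 2) ^ (q - 1)) t := by
  have h : HasDerivAt (fun s : ℝ => a - 2 * b * s - s ^ 2) (-2 * b - 2 * t) t := by
    refine ((((hasDerivAt_id t).const_mul (2 * b)).const_sub a).sub
      ((hasDerivAt_id t).pow 2)).congr_deriv ?_
    simp
  exact h.rpow_const (Or.inl ht.ne')

section Barrier

variable {n : ℕ} {W : EuclideanSpace ℝ (Fin n) → ℝ}

open Filter Topology in
/-- A `C²` function touched from above at `x` by `M * (T - ‖·‖ ^ 2) ^ (-k)` has second derivative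
along a unit vector `e` at most that of the barrier. -/
theorem second_deriv_le_of_barrier (hW : ContDiff ℝ 2 W) {M T k : ℝ}
    {x e : EuclideanSpace ℝ (Fin n)} (he : ‖e‖ = 1) (hx : 0 < T - ‖x‖ ^ 2)
    (hmin : IsLocalMin (fun y => M * (T - ‖y‖ ^ 2) ^ (-k) - W y) x) :
    fderiv ℝ (fun y => fderiv ℝ W y e) x e ≤
      M * (4 * k * (k + 1) * inner ℝ x e ^ 2 * (T - ‖x‖ ^ 2) ^ (-k - 2)
        + 2 * k * (T - ‖x‖ ^ 2) ^ (-k - 1)) := by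
  set a := T - ‖x‖ ^ 2 with ha
  set b := inner ℝ x e with hb
  let Q : ℝ → ℝ := fun t => a - 2 * b * t - t ^ 2
  have hline (t : ℝ) : HasDerivAt (fun s : ℝ => x + s • e) e t := by
    simpa using ((hasDerivAt_id t).smul_const e).const_add x
  have hQ (t : ℝ) : T - ‖x + t • e‖ ^ 2 = Q t := by
    simp only [Q, ha, hb, norm_add_sq_real, inner_smul_right, norm_smul, he, Real.norm_eq_abs,
      mul_one, sq_abs]
    ring
  have hQpos : ∀ᶠ t in 𝓝 (0 : ℝ), 0 < Q t := by
    have hcont : ContinuousAt Q 0 := by fun_prop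
    exact hcont.eventually (lt_mem_nhds (by simpa [Q] using hx))
  let u : ℝ → ℝ := fun t => M * Q t ^ (-k) - W (x + t • e)
  let u' : ℝ → ℝ := fun t =>
    M * ((-2 * b - 2 * t) * (-k) * Q t ^ (-k - 1)) - fderiv ℝ W (x + t • e) e
  have hu (t : ℝ) (ht : 0 < Q t) : HasDerivAt u (u' t) t :=
    ((hasDerivAt_quadratic_rpow a b (-k) t ht).const_mul M).sub
      ((hW.differentiable (by norm_num) _).hasFDerivAt.comp_hasDerivAt t (hline t))
  have hmin' : IsLocalMin u 0 := by
    have hcont : Tendsto (fun t : ℝ => x + t • e) (𝓝 0) (𝓝 x) := by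
      simpa [ContinuousAt] using (hline 0).continuousAt
    filter_upwards [hcont.eventually hmin] with t ht
    simpa [u, ← hQ] using ht
  have hdW : Differentiable ℝ (fun y => fderiv ℝ W y e) :=
    ((hW.fderiv_right (m := 1) (by norm_num)).differentiable (by norm_num)).clm_apply
      (differentiable_const e)
  have hdW' : HasDerivAt (fun t : ℝ => fderiv ℝ W (x + t • e) e)
      (fderiv ℝ (fun y => fderiv ℝ W y e) x e) 0 := by
    have h := (hdW (x + (0 : ℝ) • e)).hasFDerivAt.comp_hasDerivAt 0 (hline 0)
    simpa [Function.comp_def] using h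
  have hlin : HasDerivAt (fun t : ℝ => (-2 * b - 2 * t) * (-k)) (2 * k) 0 := by
    have h := (((hasDerivAt_id (0 : ℝ)).const_mul 2).const_sub (-2 * b)).mul_const (-k)
    exact h.congr_deriv (by ring)
  have hQ0 : 0 < Q 0 := hQpos.self_of_nhds
  have hu' := ((hlin.mul (hasDerivAt_quadratic_rpow a b (-k - 1) 0 hQ0)).const_mul M).sub hdW'
  have hderiv : deriv u =ᶠ[𝓝 0] u' := hQpos.mono fun t ht => (hu t ht).deriv
  have hnonneg := hmin'.deriv_deriv_nonneg (hu 0 hQ0).continuousAt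
  rw [hderiv.deriv_eq, HasDerivAt.deriv (f := u') hu'] at hnonneg
  have hexp : -k - 1 - 1 = -k - 2 := by ring
  simp only [mul_zero, sub_zero, ne_eq, OfNat.ofNat_ne_zero, not_false_eq_true, zero_pow,
    hexp] at hnonneg
  linarith

/-- The Keller–Osserman bound for the Laplacian at a point where the barrier touches. -/
theorem laplacian_le_of_barrier (hW : ContDiff ℝ 2 W) {M T k : ℝ} (hM : 0 ≤ M) (hk : 0 ≤ k)
    {x : EuclideanSpace ℝ (Fin n)} (hx : 0 < T - ‖x‖ ^ 2)
    (hmin : IsLocalMin (fun y => M * (T - ‖y‖ ^ 2) ^ (-k) - W y) x) :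
    laplacian W x ≤
      M * (T - ‖x‖ ^ 2) ^ (-k - 2) * ((4 * k * (k + 1) + 2 * k * n) * T) := by
  set a := T - ‖x‖ ^ 2 with ha
  have hsum : ∑ i : Fin n, inner ℝ x (EuclideanSpace.single i (1 : ℝ)) ^ 2 = ‖x‖ ^ 2 := by
    rw [EuclideanSpace.real_norm_sq_eq]
    simp [EuclideanSpace.inner_single_right]
  have hpow : a ^ (-k - 1) = a ^ (-k - 2) * a := by
    rw [← Real.rpow_add_one hx.ne']
    congr 1
    ring
  calc laplacian W x
      ≤ ∑ i : Fin n, M * (4 * k * (k + 1) * inner ℝ x (EuclideanSpace.single i (1 : ℝ)) ^ 2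
          * a ^ (-k - 2) + 2 * k * a ^ (-k - 1)) :=
        Finset.sum_le_sum fun i _ => second_deriv_le_of_barrier hW (by simp) hx hmin
    _ = M * a ^ (-k - 2) * (4 * k * (k + 1) * ‖x‖ ^ 2 + 2 * k * n * a) := by
        rw [← Finset.mul_sum, Finset.sum_add_distrib, ← Finset.sum_mul, ← Finset.mul_sum, hsum,
          Finset.sum_const, hpow]
        simp
        ring
    _ ≤ M * a ^ (-k - 2) * ((4 * k * (k + 1) + 2 * k * n) * T) := by
        have hxT : ‖x‖ ^ 2 ≤ T := by linarith
        have haT : a ≤ T := by linarith [sq_nonneg ‖x‖]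
        rw [add_mul]
        gcongr

open Metric in
/-- Keller–Osserman estimate on the ball of radius `√T`. -/
theorem keller_osserman_bound {p α : ℝ} (hp : 1 < p) (hα : 0 < α) (hW : ContDiff ℝ 2 W)
    (hsub : ∀ x, 0 < W x → α * W x * W x ^ (p - 1) ≤ laplacian W x)
    {T : ℝ} {y : EuclideanSpace ℝ (Fin n)} (hy : 0 < W y) (hyT : ‖y‖ ^ 2 < T) :
    α * (W y ^ (p - 1) * (T - ‖y‖ ^ 2) ^ 2) ≤
      (4 * (2 / (p - 1)) * (2 / (p - 1) + 1) + 2 * (2 / (p - 1)) * n) * T := by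
  set k := 2 / (p - 1) with hk
  have hp' : 0 < p - 1 := by linarith
  have hkpos : 0 < k := by positivity
  have hkp : k * (p - 1) = 2 := by rw [hk]; field_simp
  have hT : 0 ≤ T := (sq_nonneg _).trans hyT.le
  let F : EuclideanSpace ℝ (Fin n) → ℝ := fun x => W x * (T - ‖x‖ ^ 2) ^ k
  have hF : Continuous F := by
    refine hW.continuous.mul (Continuous.rpow_const (by fun_prop) fun _ => Or.inr hkpos.le)
  have hball (x : EuclideanSpace ℝ (Fin n)) : x ∈ closedBall 0 √T ↔ ‖x‖ ^ 2 ≤ T := by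
    rw [mem_closedBall_zero_iff, Real.le_sqrt (norm_nonneg x) hT]
  obtain ⟨x, hxmem, hxmax⟩ := (isCompact_closedBall (0 : EuclideanSpace ℝ (Fin n)) √T).exists_isMaxOn
    ⟨y, (hball y).2 hyT.le⟩ hF.continuousOn
  have hyx : F y ≤ F x := hxmax ((hball y).2 hyT.le)
  have hFy : 0 < F y := mul_pos hy (Real.rpow_pos_of_pos (by linarith) k)
  have hFx : 0 < F x := hFy.trans_le hyx
  have hxT : 0 < T - ‖x‖ ^ 2 := by
    refine (sub_nonneg.2 ((hball x).1 hxmem)).lt_of_ne fun h => ?_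
    simp [F, ← h, Real.zero_rpow hkpos.ne'] at hFx
  have hWx : 0 < W x := pos_of_mul_pos_left hFx (Real.rpow_nonneg hxT.le k)
  have hWeq (z : EuclideanSpace ℝ (Fin n)) (hz : 0 < T - ‖z‖ ^ 2) :
      W z = F z * (T - ‖z‖ ^ 2) ^ (-k) := by
    simp only [F]
    rw [mul_assoc, ← Real.rpow_add hz]
    simp
  have hmin : IsLocalMin (fun z => F x * (T - ‖z‖ ^ 2) ^ (-k) - W z) x := by
    have hcont : Continuous fun z : EuclideanSpace ℝ (Fin n) => T - ‖z‖ ^ 2 := by fun_prop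
    filter_upwards [hcont.continuousAt.eventually (lt_mem_nhds hxT)] with z hz
    have hzx : F z ≤ F x := hxmax ((hball z).2 (by linarith))
    rw [← hWeq x hxT, sub_self, hWeq z hz, ← sub_mul]
    exact mul_nonneg (sub_nonneg.2 hzx) (Real.rpow_nonneg hz.le _)
  have hlap := (hsub x hWx).trans (laplacian_le_of_barrier hW hFx.le hkpos.le hxT hmin)
  have hpow (z : EuclideanSpace ℝ (Fin n)) (hz : 0 < T - ‖z‖ ^ 2) (hWz : 0 < W z) :
      F z ^ (p - 1) = W z ^ (p - 1) * (T - ‖z‖ ^ 2) ^ 2 := by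
    simp only [F]
    rw [Real.mul_rpow hWz.le (Real.rpow_nonneg hz.le k), ← Real.rpow_mul hz.le, hkp,
      Real.rpow_two]
  have hmono : F y ^ (p - 1) ≤ F x ^ (p - 1) := Real.rpow_le_rpow hFy.le hyx hp'.le
  rw [← hpow y (by linarith) hy]
  refine (mul_le_mul_of_nonneg_left hmono hα.le).trans ?_
  rw [hpow x hxT hWx]
  have hsplit : F x * (T - ‖x‖ ^ 2) ^ (-k - 2) * (T - ‖x‖ ^ 2) ^ 2 = W x := by
    rw [hWeq x hxT, mul_assoc, ← Real.rpow_ofNat (T - ‖x‖ ^ 2) 2, ← Real.rpow_add hxT]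
    ring_nf
  refine le_of_mul_le_mul_left ?_ hWx
  have hscaled := mul_le_mul_of_nonneg_right hlap (sq_nonneg (T - ‖x‖ ^ 2))
  calc W x * (α * (W x ^ (p - 1) * (T - ‖x‖ ^ 2) ^ 2))
      = α * W x * W x ^ (p - 1) * (T - ‖x‖ ^ 2) ^ 2 := by ring
    _ ≤ _ := hscaled
    _ = F x * (T - ‖x‖ ^ 2) ^ (-k - 2) * (T - ‖x‖ ^ 2) ^ 2
          * ((4 * k * (k + 1) + 2 * k * n) * T) := by ring
    _ = _ := by rw [hsplit]

/-- An entire function satisfying `ΔW ≥ α W ^ p` wherever it is positive is nonpositive. -/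
theorem nonpos_of_entire_subsolution {p α : ℝ} (hp : 1 < p) (hα : 0 < α) (hW : ContDiff ℝ 2 W)
    (hsub : ∀ x, 0 < W x → α * W x * W x ^ (p - 1) ≤ laplacian W x)
    (y : EuclideanSpace ℝ (Fin n)) : W y ≤ 0 := by
  by_contra! hy
  have hp' : 0 < p - 1 := by linarith
  set D := 4 * (2 / (p - 1)) * (2 / (p - 1) + 1) + 2 * (2 / (p - 1)) * n with hD
  have hDpos : 0 ≤ D := by positivity
  set c := α * W y ^ (p - 1) with hc
  have hcpos : 0 < c := mul_pos hα (Real.rpow_pos_of_pos hy _)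
  set s := ‖y‖ ^ 2 with hs
  have hspos : 0 ≤ s := sq_nonneg _
  set r := 1 + (D * s + D) / c with hr
  have hr1 : 1 ≤ r := le_add_of_nonneg_right (by positivity)
  have hcr : c * r = c + (D * s + D) := by rw [hr]; field_simp
  have hbound := keller_osserman_bound hp hα hW hsub hy (T := s + r) (by linarith)
  rw [← mul_assoc, ← hc, ← hs, ← hD, add_sub_cancel_left] at hbound
  have hsq : c * r ^ 2 = (c + (D * s + D)) * r := by rw [← hcr]; ring
  nlinarith [mul_nonneg (mul_nonneg hDpos hspos) (sub_nonneg.2 hr1), mul_pos hcpos (by linarith : 0 < r)]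

theorem laplacian_neg_apply (f : EuclideanSpace ℝ (Fin n) → ℝ) (x : EuclideanSpace ℝ (Fin n)) :
    laplacian (fun y => -f y) x = -laplacian f x := by
  simp [laplacian, fderiv_fun_neg, Finset.sum_neg_distrib]

end Barrier

theorem stmt_13 (n : ℕ) (hn : 1 ≤ n) (p α : ℝ) (hp : 1 < p) (hα : 0 < α)
    (W : EuclideanSpace ℝ (Fin n) → ℝ) (hW : ContDiff ℝ 2 W)
    (heq : ∀ x, laplacian W x = α * W x * |W x| ^ (p - 1)) :
    ∀ x, W x = 0 := by
  intro x
  refine le_antisymm (nonpos_of_entire_subsolution hp hα hW (fun y hy => ?_) x)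
    (neg_nonpos.1 (nonpos_of_entire_subsolution hp hα hW.neg (fun y hy => ?_) x))
  · rw [heq, abs_of_pos hy]
  · rw [laplacian_neg_apply, heq, ← abs_neg, abs_of_pos hy]
    linarith
end

section
/- Let n ≥ 1, p > 1 and R > 0. Set C := (2(3p+1)/(p−1)²)^{1/(p−1)} and define, for x ∈ ℝⁿ with ‖x‖ < R, the function W̄(x) := C · (R²/(2n))^{1/(p−1)} · ((R² − ‖x‖²)/(2n))^{−2/(p−1)}. Then W̄ is C² on the open ball B_R(0) and satisfies ΔW̄(x) ≤ W̄(x)^p for every x with ‖x‖ < R. -/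
section RadialPower

variable {n : ℕ}

/-- The derivative of a real power of `(c - ‖y‖ ^ 2) / (2 * n)`. -/
theorem hasFDerivAt_sub_norm_sq_div_rpow (c s : ℝ) {x : EuclideanSpace ℝ (Fin n)}
    (hx : (c - ‖x‖ ^ 2) / (2 * (n : ℝ)) ≠ 0) :
    HasFDerivAt (fun y : EuclideanSpace ℝ (Fin n) => ((c - ‖y‖ ^ 2) / (2 * (n : ℝ))) ^ s)
      ((-(s / n) * ((c - ‖x‖ ^ 2) / (2 * (n : ℝ))) ^ (s - 1)) • innerSL ℝ x) x := by
  have h := ((((hasStrictFDerivAt_norm_sq x).hasFDerivAt.const_sub c).mul_const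
    (2 * (n : ℝ))⁻¹)).rpow_const (p := s) (Or.inl (by simpa [div_eq_mul_inv] using hx))
  simp only [← div_eq_mul_inv] at h
  refine h.congr_fderiv ?_
  ext v
  simp
  ring

/-- The Laplacian of a real power of `(c - ‖y‖ ^ 2) / (2 * n)`. -/
theorem laplacian_const_mul_sub_norm_sq_div_rpow (hn : n ≠ 0) (K c s : ℝ)
    {x : EuclideanSpace ℝ (Fin n)} (hx : 0 < (c - ‖x‖ ^ 2) / (2 * (n : ℝ))) :
    laplacian (fun y => K * ((c - ‖y‖ ^ 2) / (2 * (n : ℝ))) ^ s) x =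
      K * (s * (s - 1) * (‖x‖ ^ 2 / (n : ℝ) ^ 2) * ((c - ‖x‖ ^ 2) / (2 * (n : ℝ))) ^ (s - 2) -
        s * ((c - ‖x‖ ^ 2) / (2 * (n : ℝ))) ^ (s - 1)) := by
  have hn' : (n : ℝ) ≠ 0 := Nat.cast_ne_zero.2 hn
  have hpos : ∀ᶠ y in nhds x, 0 < (c - ‖y‖ ^ 2) / (2 * (n : ℝ)) :=
    continuousAt_const.eventually_lt (by fun_prop) hx
  have hterm (i : Fin n) :
      fderiv ℝ (fun y => fderiv ℝ (fun y => K * ((c - ‖y‖ ^ 2) / (2 * (n : ℝ))) ^ s) y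
        (EuclideanSpace.single i 1)) x (EuclideanSpace.single i 1) =
      K * (s * (s - 1) / (n : ℝ) ^ 2 * ((c - ‖x‖ ^ 2) / (2 * (n : ℝ))) ^ (s - 2)) * x i ^ 2 -
        K * (s / n * ((c - ‖x‖ ^ 2) / (2 * (n : ℝ))) ^ (s - 1)) := by
    have hfirst : (fun y => fderiv ℝ (fun y => K * ((c - ‖y‖ ^ 2) / (2 * (n : ℝ))) ^ s) y
        (EuclideanSpace.single i 1)) =ᶠ[nhds x]
        fun y => (-(K * s / n) * ((c - ‖y‖ ^ 2) / (2 * (n : ℝ))) ^ (s - 1)) *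
          EuclideanSpace.proj (𝕜 := ℝ) i y := by
      filter_upwards [hpos] with y hy
      rw [((hasFDerivAt_sub_norm_sq_div_rpow c s hy.ne').const_mul K).fderiv]
      simp [EuclideanSpace.inner_single_right]
      ring
    rw [hfirst.fderiv_eq, (((hasFDerivAt_sub_norm_sq_div_rpow c (s - 1) hx.ne').const_mul
      (-(K * s / n))).fun_mul (EuclideanSpace.proj (𝕜 := ℝ) i).hasFDerivAt).fderiv]
    have hs : s - 1 - 1 = s - 2 := by ring
    simp [EuclideanSpace.inner_single_right, hs]
    ring
  simp only [laplacian, hterm]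
  rw [Finset.sum_sub_distrib, ← Finset.mul_sum, ← EuclideanSpace.real_norm_sq_eq]
  simp only [Finset.sum_const, Finset.card_univ, Fintype.card_fin, nsmul_eq_mul]
  field_simp

end RadialPower

theorem stmt_14 (n : ℕ) (hn : 1 ≤ n) (p R C : ℝ) (hp : 1 < p) (hR : 0 < R)
    (hC : C = (2 * (3 * p + 1) / (p - 1) ^ 2) ^ (1 / (p - 1)))
    (W : EuclideanSpace ℝ (Fin n) → ℝ)
    (hW : ∀ x, W x = C * (R ^ 2 / (2 * (n : ℝ))) ^ (1 / (p - 1)) *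
      ((R ^ 2 - ‖x‖ ^ 2) / (2 * (n : ℝ))) ^ (-2 / (p - 1))) :
    ContDiffOn ℝ 2 W (Metric.ball 0 R) ∧
      ∀ x : EuclideanSpace ℝ (Fin n), ‖x‖ < R → laplacian W x ≤ W x ^ p := by
  have hn0 : (1 : ℝ) ≤ n := by exact_mod_cast hn
  have hp1 : 0 < p - 1 := sub_pos.2 hp
  have hpos {x : EuclideanSpace ℝ (Fin n)} (hx : ‖x‖ < R) :
      0 < (R ^ 2 - ‖x‖ ^ 2) / (2 * (n : ℝ)) :=
    div_pos (sub_pos.2 (pow_lt_pow_left₀ hx (norm_nonneg x) two_ne_zero)) (by positivity)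
  obtain rfl := funext hW
  refine ⟨?_, fun x hx => ?_⟩
  · refine contDiffOn_const.mul (ContDiffOn.rpow_const_of_ne ?_ fun x hx => ?_)
    · exact ((contDiff_const.sub (contDiff_norm_sq ℝ)).div_const _).contDiffOn
    · exact (hpos (mem_ball_zero_iff.1 hx)).ne'
  rw [laplacian_const_mul_sub_norm_sq_div_rpow (by lia) _ _ _ (hpos hx)]
  have hu := hpos hx
  set u := (R ^ 2 - ‖x‖ ^ 2) / (2 * (n : ℝ)) with hu_def
  set M := R ^ 2 / (2 * (n : ℝ)) with hM_def
  have hM : 0 < M := by positivity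
  have hA : 0 < 2 * (3 * p + 1) / (p - 1) ^ 2 := by positivity
  have hC0 : 0 < C := hC ▸ Real.rpow_pos_of_pos hA _
  have hK0 : 0 < C * M ^ (1 / (p - 1)) := mul_pos hC0 (Real.rpow_pos_of_pos hM _)
  have hKp : (C * M ^ (1 / (p - 1))) ^ p =
      C * M ^ (1 / (p - 1)) * (2 * (3 * p + 1) / (p - 1) ^ 2 * M) := by
    have hroot : (C * M ^ (1 / (p - 1))) ^ (p - 1) = 2 * (3 * p + 1) / (p - 1) ^ 2 * M := by
      rw [hC, ← Real.mul_rpow hA.le hM.le, ← Real.rpow_mul (by positivity),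
        one_div_mul_cancel hp1.ne', Real.rpow_one]
    rw [← hroot, ← Real.rpow_one_add' hK0.le (by linarith)]
    congr 1
    ring
  have hup : (u ^ (-2 / (p - 1))) ^ p = u ^ (-2 / (p - 1) - 2) := by
    rw [← Real.rpow_mul hu.le]
    congr 1
    field_simp
    ring
  have hus : u ^ (-2 / (p - 1) - 1) = u ^ (-2 / (p - 1) - 2) * u := by
    rw [← Real.rpow_add_one hu.ne']
    congr 1
    ring
  rw [Real.mul_rpow hK0.le (by positivity), hKp, hup, hus]
  have hnorm : ‖x‖ ^ 2 / (n : ℝ) ^ 2 ≤ 2 * (M - u) := by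
    have h : 2 * (M - u) = ‖x‖ ^ 2 / n := by
      rw [hM_def, hu_def]
      field_simp
      ring
    rw [h]
    gcongr
    exact le_self_pow₀ hn0 two_ne_zero
  have key : -2 / (p - 1) * (-2 / (p - 1) - 1) * (‖x‖ ^ 2 / (n : ℝ) ^ 2) - -2 / (p - 1) * u ≤
      2 * (3 * p + 1) / (p - 1) ^ 2 * M := by
    have hMu : 0 ≤ M - u := by
      have : 0 ≤ ‖x‖ ^ 2 / (n : ℝ) ^ 2 := by positivity
      linarith
    have h : (p + 1) * (‖x‖ ^ 2 / (n : ℝ) ^ 2) + (p - 1) * u ≤ (3 * p + 1) * M := by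
      nlinarith [mul_le_mul_of_nonneg_left hnorm (by linarith : 0 ≤ p + 1)]
    calc _ = 2 / (p - 1) ^ 2 * ((p + 1) * (‖x‖ ^ 2 / (n : ℝ) ^ 2) + (p - 1) * u) := by
          field_simp
          ring
      _ ≤ 2 / (p - 1) ^ 2 * ((3 * p + 1) * M) := by gcongr
      _ = _ := by ring
  calc _ = C * M ^ (1 / (p - 1)) * u ^ (-2 / (p - 1) - 2) *
        (-2 / (p - 1) * (-2 / (p - 1) - 1) * (‖x‖ ^ 2 / (n : ℝ) ^ 2) - -2 / (p - 1) * u) := by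
        ring
    _ ≤ C * M ^ (1 / (p - 1)) * u ^ (-2 / (p - 1) - 2) *
        (2 * (3 * p + 1) / (p - 1) ^ 2 * M) := by gcongr
    _ = _ := by ring
end
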